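/- For s > 0, there is a constant C_s such that for every k ≥ 1, the limit as ε → 0 of the probability (with respect to an absolutely continuous probability measure ℙ on (x,α) ∈ [0,1)²) that the number of hits 𝒩_ε(x, α, s) is at least k, is bounded above by C_s·k⁻³. -/

import Mathlib

open MeasureTheory

/-- `𝒩_ε(x, α, s)`: the number of `j ∈ ℤ ∩ (0, ε⁻¹s]` with `jα + x ∈ [-ε/2, ε/2] + ℤ`. -/
noncomputable def visits (x α ε s : ℝ) : ℕ :=
  Set.ncard {j : ℕ | 0 < j ∧ (j : ℝ) ≤ ε⁻¹ * s ∧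
    ∃ m : ℤ, |(j : ℝ) * α + x - m| ≤ ε / 2}

/-- If the orbit of `x` under rotation by `α` visits the `ε`-interval often within time `ε⁻¹ * s`,
then `x` and `α` are both close to fractions with a common small denominator: many of the lattice
points recording the visits lie on one line, and the primitive vector of that line is short. -/
theorem exists_denominator_of_lt_visits {x α ε s : ℝ} (hε : 0 < ε) {n : ℕ}
    (hn : 1 ≤ n) (h : (2 * ⌊2 * s⌋₊ + 1) * n < visits x α ε s) :
    ∃ q : ℕ, 1 ≤ q ∧ (n : ℝ) * q ≤ ε⁻¹ * s ∧ (∃ p : ℤ, n * |q * α - p| ≤ ε) ∧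
      ∃ l : ℤ, n * |q * x - l| ≤ 3 * s / 2 := by
  set m : ℕ → ℤ := fun j => round ((j : ℝ) * α + x) with hm
  set e : ℕ → ℝ := fun j => (j : ℝ) * α + x - m j with he
  set S := {j : ℕ | 0 < j ∧ (j : ℝ) ≤ ε⁻¹ * s ∧ ∃ m : ℤ, |(j : ℝ) * α + x - m| ≤ ε / 2} with hS
  have hfin : S.Finite := (Set.finite_Iic ⌊ε⁻¹ * s⌋₊).subset fun j hj => Nat.le_floor hj.2.1
  set F := hfin.toFinset with hF
  have hcard : (2 * ⌊2 * s⌋₊ + 1) * n < F.card := by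
    rw [hF, ← Set.ncard_eq_toFinset_card S hfin]; exact h
  have hj0 : ∀ j ∈ F, (0 : ℝ) < j := fun j hj => by
    have := (hfin.mem_toFinset.1 hj).1
    exact_mod_cast this
  have hjs : ∀ j ∈ F, (j : ℝ) ≤ ε⁻¹ * s := fun j hj => (hfin.mem_toFinset.1 hj).2.1
  have hje : ∀ j ∈ F, |e j| ≤ ε / 2 := fun j hj => by
    obtain ⟨k, hk⟩ := (hfin.mem_toFinset.1 hj).2.2
    exact (round_le _ k).trans hk
  have hee : ∀ i ∈ F, ∀ j ∈ F, |e i - e j| ≤ ε := fun i hi j hj => by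
    have h1 := abs_le.1 (hje i hi)
    have h2 := abs_le.1 (hje j hj)
    rw [abs_le]; constructor <;> linarith
  have hjj : ∀ i ∈ F, ∀ j ∈ F, |(i : ℝ) - j| ≤ ε⁻¹ * s := fun i hi j hj => by
    have h1 := hj0 i hi
    have h2 := hj0 j hj
    have h3 := hjs i hi
    have h4 := hjs j hj
    rw [abs_le]; constructor <;> linarith
  have hm_e : ∀ j, (m j : ℝ) = j * α + x - e j := fun j => by simp [he]
  have hεs : ε⁻¹ * s * ε = s := by field_simp
  obtain ⟨j₁, h₁, j₂, h₂, h12⟩ : ∃ j₁ ∈ F, ∃ j₂ ∈ F, j₁ < j₂ := by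
    have : 1 < F.card := lt_of_le_of_lt (by nlinarith) hcard
    obtain ⟨a, ha, b, hb, hab⟩ := Finset.one_lt_card.1 this
    rcases lt_or_gt_of_ne hab with h | h
    exacts [⟨a, ha, b, hb, h⟩, ⟨b, hb, a, ha, h⟩]
  set d : ℕ → ℤ := fun j => ((j₂ : ℤ) - j₁) * (m j - m j₁) - (m j₂ - m j₁) * ((j : ℤ) - j₁) with hd
  have hmaps : ∀ j ∈ F, d j ∈ Finset.Icc (-(⌊2 * s⌋₊ : ℤ)) ⌊2 * s⌋₊ := fun j hj => by
    have hdr : (d j : ℝ) = (e j₂ - e j₁) * ((j : ℝ) - j₁) - ((j₂ : ℝ) - j₁) * (e j - e j₁) := by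
      simp only [hd]; push_cast; rw [hm_e, hm_e, hm_e]; ring
    have hb : |(d j : ℝ)| ≤ 2 * s := by
      rw [hdr]
      refine (abs_sub _ _).trans ?_
      rw [abs_mul, abs_mul]
      have := mul_le_mul (hee j₂ h₂ j₁ h₁) (hjj j hj j₁ h₁) (abs_nonneg _) hε.le
      have := mul_le_mul (hjj j₂ h₂ j₁ h₁) (hee j hj j₁ h₁) (abs_nonneg _)
        ((abs_nonneg _).trans (hjj j₂ h₂ j₁ h₁))
      linarith
    have : (d j).natAbs ≤ ⌊2 * s⌋₊ := Nat.le_floor (by rw [Nat.cast_natAbs]; exact_mod_cast hb)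
    rw [Finset.mem_Icc]; omega
  obtain ⟨y, -, hy⟩ := Finset.exists_lt_card_fiber_of_mul_lt_card_of_maps_to (n := n) hmaps
    (by rw [Int.card_Icc]; convert hcard using 2; omega)
  set T := F.filter (fun j => d j = y) with hT
  have hTF : ∀ j ∈ T, j ∈ F := fun j hj => (Finset.mem_filter.1 hj).1
  have hb0 : (0 : ℤ) < (j₂ : ℤ) - j₁ := by omega
  obtain ⟨p, q, hpq, hp, hq⟩ := Int.exists_gcd_one (m := m j₂ - m j₁) (n := (j₂ : ℤ) - j₁)
    (Int.gcd_pos_of_ne_zero_right _ hb0.ne')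
  set g : ℤ := (Int.gcd (m j₂ - m j₁) ((j₂ : ℤ) - j₁) : ℤ) with hg
  have hg0 : 0 < g := by
    have := Int.gcd_pos_of_ne_zero_right (m j₂ - m j₁) hb0.ne'
    rw [hg]; exact_mod_cast this
  have hq0 : 0 < q := by
    rw [hq] at hb0; exact pos_of_mul_pos_left hb0 hg0.le
  have hline : ∀ i ∈ T, ∀ j ∈ T, q * (m i - m j) = p * ((i : ℤ) - j) := fun i hi j hj => by
    have h1 := (Finset.mem_filter.1 hi).2
    have h2 := (Finset.mem_filter.1 hj).2
    simp only [hd] at h1 h2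
    rw [hp, hq] at h1 h2
    have : g * (q * (m i - m j)) = g * (p * ((i : ℤ) - j)) := by linear_combination h1 - h2
    exact mul_left_cancel₀ hg0.ne' this
  have hdvd : ∀ i ∈ T, ∀ j ∈ T, q ∣ (i : ℤ) - j := fun i hi j hj =>
    (Int.isCoprime_iff_gcd_eq_one.2 hpq).symm.dvd_of_dvd_mul_left ⟨_, (hline i hi j hj).symm⟩
  have hTne : T.Nonempty := Finset.card_pos.1 (by omega)
  set lo := T.min' hTne with hlo
  set hi := T.max' hTne with hhi
  have hloT : lo ∈ T := T.min'_mem hTne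
  have hhiT : hi ∈ T := T.max'_mem hTne
  obtain ⟨N, hN⟩ := hdvd hi hhiT lo hloT
  have hnN : (n : ℤ) ≤ N := by
    have hc : T.card ≤ (Finset.Icc (0 : ℤ) N).card := by
      refine Finset.card_le_card_of_injOn (fun j => ((j : ℤ) - lo) / q) ?_ ?_
      · intro j hj
        obtain ⟨c, hc⟩ := hdvd j hj lo hloT
        have h1 : (lo : ℤ) ≤ j := by exact_mod_cast T.min'_le j hj
        have h2 : (j : ℤ) ≤ hi := by exact_mod_cast T.le_max' j hj
        simp only [Finset.coe_Icc, Set.mem_Icc]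
        rw [hc, Int.mul_ediv_cancel_left _ hq0.ne']
        constructor
        · by_contra! hlt
          nlinarith
        · by_contra! hlt
          nlinarith
      · intro i hi j hj hij
        obtain ⟨c, hc⟩ := hdvd i hi lo hloT
        obtain ⟨c', hc'⟩ := hdvd j hj lo hloT
        simp only at hij
        rw [hc, hc', Int.mul_ediv_cancel_left _ hq0.ne', Int.mul_ediv_cancel_left _ hq0.ne'] at hij
        rw [hij] at hc
        omega
    rw [Int.card_Icc] at hc
    omega
  have hmN : m hi - m lo = p * N := by
    have := hline hi hhiT lo hloT
    rw [hN] at this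
    exact mul_left_cancel₀ hq0.ne' (by linear_combination this)
  have hnNr : (n : ℝ) ≤ N := by exact_mod_cast hnN
  have hn1 : (1 : ℝ) ≤ n := by exact_mod_cast hn
  have hq0r : (0 : ℝ) < q := by exact_mod_cast hq0
  have hNr : (hi : ℝ) - lo = q * N := by exact_mod_cast hN
  have hmNr : (m hi : ℝ) - m lo = p * N := by exact_mod_cast hmN
  have hnq : (n : ℝ) * q ≤ ε⁻¹ * s := by
    have := (abs_le.1 (hjj hi (hTF _ hhiT) lo (hTF _ hloT))).2
    rw [hNr] at this
    nlinarith
  have hnp : (n : ℝ) * |q * α - p| ≤ ε := by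
    have h1 := hee hi (hTF _ hhiT) lo (hTF _ hloT)
    have h2 : e hi - e lo = N * (q * α - p) := by
      have h3 := hm_e hi
      have h4 := hm_e lo
      linear_combination h4 - h3 + α * hNr - hmNr
    rw [h2, abs_mul, abs_of_nonneg (by linarith : (0 : ℝ) ≤ N)] at h1
    exact (mul_le_mul_of_nonneg_right hnNr (abs_nonneg _)).trans h1
  have hqn : ((q.toNat : ℕ) : ℝ) = q := by
    have : ((q.toNat : ℕ) : ℤ) = q := Int.toNat_of_nonneg hq0.le
    exact_mod_cast this
  refine ⟨q.toNat, by omega, by rwa [hqn], ⟨p, by rwa [hqn]⟩, q * m j₁ - p * j₁, ?_⟩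
  rw [hqn]
  push_cast
  have hx : (q : ℝ) * x - (q * m j₁ - p * j₁) = q * e j₁ - j₁ * (q * α - p) := by
    rw [hm_e]; ring
  rw [hx]
  have h3 : |(q : ℝ) * e j₁ - j₁ * (q * α - p)| ≤ q * |e j₁| + j₁ * |q * α - p| := by
    refine (abs_sub _ _).trans ?_
    rw [abs_mul, abs_mul, abs_of_pos hq0r, abs_of_pos (hj0 _ h₁)]
  have h4 := mul_le_mul hnq (hje j₁ h₁) (abs_nonneg _) (by nlinarith)
  have h5 := mul_le_mul (hjs j₁ h₁) hnp (by positivity) (by nlinarith)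
  nlinarith [mul_le_mul_of_nonneg_left h3 (by linarith : (0 : ℝ) ≤ n)]

/-- The reals `x` such that `q * x` is within `t` of an integer. -/
def nearRationals (q : ℕ) (t : ℝ) : Set ℝ :=
  {x : ℝ | ∃ l : ℤ, |q * x - l| ≤ t}

theorem measurableSet_nearRationals (q : ℕ) (t : ℝ) : MeasurableSet (nearRationals q t) := by
  have : nearRationals q t = ⋃ l : ℤ, {x : ℝ | |q * x - l| ≤ t} := by
    ext x; simp [nearRationals]
  rw [this]
  exact MeasurableSet.iUnion fun l => measurableSet_le (by fun_prop) measurable_const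

theorem volume_Ico_inter_nearRationals_le {a ρ t : ℝ} (hρ : 0 ≤ ρ) (ht : 0 ≤ t)
    {q : ℕ} (hq : 1 ≤ q) :
    volume (Set.Ico a (a + ρ) ∩ nearRationals q t) ≤
      ENNReal.ofReal ((ρ + (2 * t + 1) / q) * (2 * t)) := by
  have hq0 : (0 : ℝ) < q := by exact_mod_cast hq
  set I := Finset.Icc ⌈q * a - t⌉ ⌊q * (a + ρ) + t⌋ with hI
  have hsub : Set.Ico a (a + ρ) ∩ nearRationals q t ⊆
      ⋃ l ∈ I, Set.Icc ((l - t) / q) ((l + t) / q) := by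
    rintro x ⟨⟨h1, h2⟩, l, hl⟩
    rw [abs_le] at hl
    simp only [Set.mem_iUnion]
    refine ⟨l, ?_, ?_, ?_⟩
    · rw [hI, Finset.mem_Icc, Int.ceil_le, Int.le_floor]
      constructor <;> nlinarith
    · rw [div_le_iff₀ hq0]; linarith
    · rw [le_div_iff₀ hq0]; linarith
  have hcard : (I.card : ℝ) ≤ q * ρ + 2 * t + 1 := by
    have hnn : (0 : ℝ) ≤ q * ρ + 2 * t + 1 := by positivity
    have h1 := Int.le_ceil (q * a - t)
    have h2 := Int.floor_le (q * (a + ρ) + t)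
    have h3 : ((I.card : ℤ) : ℝ) ≤ q * ρ + 2 * t + 1 := by
      rw [hI, Int.card_Icc, Int.ofNat_toNat]
      push_cast
      exact max_le (by linarith) hnn
    exact_mod_cast h3
  calc _ ≤ ∑ l ∈ I, volume (Set.Icc (((l : ℝ) - t) / q) ((l + t) / q)) :=
        (measure_mono hsub).trans (measure_biUnion_finset_le _ _)
    _ = ∑ l ∈ I, ENNReal.ofReal (2 * t / q) := by
        refine Finset.sum_congr rfl fun l _ => ?_
        rw [Real.volume_Icc]; congr 1; ring
    _ = ENNReal.ofReal (I.card * (2 * t / q)) := by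
        rw [Finset.sum_const, nsmul_eq_mul, ENNReal.ofReal_mul (by positivity),
          ENNReal.ofReal_natCast]
    _ ≤ _ := by
        apply ENNReal.ofReal_le_ofReal
        calc (I.card : ℝ) * (2 * t / q) ≤ (q * ρ + 2 * t + 1) * (2 * t / q) := by gcongr
          _ = _ := by field_simp; ring

/-- A measurable set of pairs `(x, α)` which contains all those with many visits, as shown by
`exists_denominator_of_lt_visits`. -/
def visitsCover (s : ℝ) (n : ℕ) (ε : ℝ) : Set (ℝ × ℝ) :=
  ⋃ q ∈ Finset.Ioo 0 (⌊ε⁻¹ * s / n⌋₊ + 1),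
    nearRationals q (3 * s / (2 * n)) ×ˢ nearRationals q (ε / n)

theorem measurableSet_visitsCover (s : ℝ) (n : ℕ) (ε : ℝ) :
    MeasurableSet (visitsCover s n ε) :=
  Finset.measurableSet_biUnion _ fun q _ =>
    (measurableSet_nearRationals q _).prod (measurableSet_nearRationals q _)

theorem mem_visitsCover_of_lt_visits {x α ε s : ℝ} (hε : 0 < ε) {n : ℕ}
    (hn : 1 ≤ n) (h : (2 * ⌊2 * s⌋₊ + 1) * n < visits x α ε s) :
    (x, α) ∈ visitsCover s n ε := by
  obtain ⟨q, hq, hqn, ⟨p, hp⟩, l, hl⟩ := exists_denominator_of_lt_visits hε hn h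
  have hn0 : (0 : ℝ) < n := by exact_mod_cast hn
  simp only [visitsCover, Set.mem_iUnion]
  refine ⟨q, ?_, ⟨l, ?_⟩, p, ?_⟩
  · have : q ≤ ⌊ε⁻¹ * s / n⌋₊ := Nat.le_floor (by rw [le_div_iff₀ hn0]; linarith)
    rw [Finset.mem_Ioo]; omega
  · rw [le_div_iff₀ (by positivity)]; linarith
  · rw [le_div_iff₀ hn0]; linarith

theorem volume_visitsCover_inter_box_le {s : ℝ} (hs : 0 < s) {n : ℕ} (hn : 1 ≤ n) {ρ : ℝ}
    (hρ : 0 ≤ ρ) {ε : ℝ} (hε : 0 < ε) (hε1 : ε ≤ 1) (a b : ℝ) :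
    volume (visitsCover s n ε ∩ Set.Ico a (a + ρ) ×ˢ Set.Ico b (b + ρ)) ≤
      ENNReal.ofReal (12 * s ^ 2 / n ^ 3 * ρ ^ 2 + 24 * s * (3 * s + 3) ^ 2 * ε) := by
  have hn1 : (1 : ℝ) ≤ n := by exact_mod_cast hn
  have hn0 : (0 : ℝ) < n := by linarith
  set t := 3 * s / (2 * n) with ht
  set u := ε / n with hu
  set B := 3 * s + 3 with hB
  have ht0 : 0 < t := by positivity
  have hu0 : 0 < u := by positivity
  have htB : 2 * t + 1 ≤ B := by
    have : 2 * t ≤ 3 * s := by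
      rw [ht, mul_div_assoc', div_le_iff₀ (by positivity)]; nlinarith
    linarith
  have huB : 2 * u + 1 ≤ B := by
    have : u ≤ 1 := by rw [hu, div_le_one hn0]; linarith
    linarith
  set Q := ⌊ε⁻¹ * s / n⌋₊ with hQ
  have hQle : (Q : ℝ) ≤ ε⁻¹ * s / n := Nat.floor_le (by positivity)
  have hsub : visitsCover s n ε ∩ Set.Ico a (a + ρ) ×ˢ Set.Ico b (b + ρ) ⊆
      ⋃ q ∈ Finset.Ioo 0 (Q + 1),
        (Set.Ico a (a + ρ) ∩ nearRationals q t) ×ˢ (Set.Ico b (b + ρ) ∩ nearRationals q u) := by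
    rintro ⟨x, y⟩ ⟨hxy, hx, hy⟩
    simp only [visitsCover, Set.mem_iUnion] at hxy ⊢
    obtain ⟨q, hq, h1, h2⟩ := hxy
    exact ⟨q, hq, ⟨hx, h1⟩, hy, h2⟩
  calc _ ≤ ∑ q ∈ Finset.Ioo 0 (Q + 1), volume ((Set.Ico a (a + ρ) ∩ nearRationals q t) ×ˢ
          (Set.Ico b (b + ρ) ∩ nearRationals q u)) :=
        (measure_mono hsub).trans (measure_biUnion_finset_le _ _)
    _ ≤ ∑ q ∈ Finset.Ioo 0 (Q + 1),
          ENNReal.ofReal ((2 * ρ ^ 2 + 2 * B ^ 2 * ((q : ℝ) ^ 2)⁻¹) * (4 * t * u)) := by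
        refine Finset.sum_le_sum fun q hq => ?_
        have hq1 : 1 ≤ q := (Finset.mem_Ioo.1 hq).1
        have hq0 : (0 : ℝ) < q := by exact_mod_cast hq1
        rw [Measure.volume_eq_prod, Measure.prod_prod]
        refine (mul_le_mul' (volume_Ico_inter_nearRationals_le hρ ht0.le hq1)
          (volume_Ico_inter_nearRationals_le hρ hu0.le hq1)).trans ?_
        rw [← ENNReal.ofReal_mul (by positivity)]
        apply ENNReal.ofReal_le_ofReal
        calc (ρ + (2 * t + 1) / q) * (2 * t) * ((ρ + (2 * u + 1) / q) * (2 * u))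
            ≤ (ρ + B / q) * (2 * t) * ((ρ + B / q) * (2 * u)) := by gcongr
          _ = (ρ + B / q) ^ 2 * (4 * t * u) := by ring
          _ ≤ (2 * ρ ^ 2 + 2 * (B / q) ^ 2) * (4 * t * u) := by
              gcongr; nlinarith [sq_nonneg (ρ - B / q)]
          _ = _ := by rw [div_pow]; ring
    _ = ENNReal.ofReal (∑ q ∈ Finset.Ioo 0 (Q + 1),
          (2 * ρ ^ 2 + 2 * B ^ 2 * ((q : ℝ) ^ 2)⁻¹) * (4 * t * u)) :=
        (ENNReal.ofReal_sum_of_nonneg fun q _ => by positivity).symm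
    _ ≤ _ := by
        apply ENNReal.ofReal_le_ofReal
        rw [← Finset.sum_mul, Finset.sum_add_distrib, Finset.sum_const, ← Finset.mul_sum,
          Nat.card_Ioo, nsmul_eq_mul]
        have h2 := sum_Ioo_inv_sq_le (α := ℝ) 0 (Q + 1)
        simp only [Nat.cast_zero, zero_add, div_one] at h2
        have hQ' : ((Q + 1 - 0 - 1 : ℕ) : ℝ) = Q := by simp
        rw [hQ']
        calc _ ≤ (ε⁻¹ * s / n * (2 * ρ ^ 2) + 2 * B ^ 2 * 2) * (4 * t * u) := by gcongr
          _ = 12 * s ^ 2 / n ^ 3 * ρ ^ 2 + 24 * s * B ^ 2 * ε / n ^ 2 := by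
              rw [ht, hu]; field_simp; ring
          _ ≤ _ := by
              gcongr
              exact div_le_self (by positivity) (one_le_pow₀ hn1)

/-- A family of sets whose density in every small square is asymptotically at most `c` has
asymptotic probability at most `c`, for any absolutely continuous probability measure on the
unit square. -/
theorem eventually_measure_le_of_box_density {ι : Type*} {l : Filter ι} {P : Measure (ℝ × ℝ)}
    [IsProbabilityMeasure P] (hsupp : P (Set.Ico (0 : ℝ) 1 ×ˢ Set.Ico (0 : ℝ) 1) = 1)
    (habs : P ≪ volume) {U : ι → Set (ℝ × ℝ)} (hU : ∀ i, MeasurableSet (U i)) {c : ℝ}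
    (hc : 0 ≤ c)
    (hbox : ∀ ρ : ℝ, 0 < ρ → ∀ a b : ℝ, ∀ᶠ i in l,
      volume (U i ∩ Set.Ico a (a + ρ) ×ˢ Set.Ico b (b + ρ)) ≤ ENNReal.ofReal (c * ρ ^ 2))
    {δ : ℝ} (hδ : 0 < δ) :
    ∀ᶠ i in l, P (U i) ≤ ENNReal.ofReal (c * (1 + 3 * δ) + δ) := by
  set D := Set.Ico (0 : ℝ) 1 ×ˢ Set.Ico (0 : ℝ) 1 with hD
  have hDm : MeasurableSet D := measurableSet_Ico.prod measurableSet_Ico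
  have hDvol : volume D = 1 := by
    rw [hD, Measure.volume_eq_prod, Measure.prod_prod]; simp
  set f := P.rnDeriv volume with hf
  have hPf : volume.withDensity f = P := Measure.withDensity_rnDeriv_eq _ _ habs
  have hfm : Measurable f := Measure.measurable_rnDeriv _ _
  have hf1 : ∫⁻ z, f z = 1 := by
    rw [← setLIntegral_univ, ← withDensity_apply _ MeasurableSet.univ, hPf, measure_univ]
  have hfint : Integrable (fun z => (f z).toReal) :=
    integrable_toReal_of_lintegral_ne_top hfm.aemeasurable (by simp [hf1])
  have hfr : ∀ᵐ z, f z = ENNReal.ofReal (f z).toReal := by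
    filter_upwards [Measure.rnDeriv_lt_top P volume] with z hz
    rw [ENNReal.ofReal_toReal hz.ne]
  obtain ⟨g, hgs, hgf, hgc, -⟩ := hfint.exists_hasCompactSupport_lintegral_sub_le
    (ε := ENNReal.ofReal δ) (by simpa using hδ)
  have hsub_le : ∀ x y : ℝ, ENNReal.ofReal x ≤ ENNReal.ofReal y + ‖x - y‖ₑ := fun x y => by
    rw [← ofReal_norm]
    refine (ENNReal.ofReal_le_ofReal ?_).trans ENNReal.ofReal_add_le
    linarith [Real.le_norm_self (x - y)]
  have hfg : ∀ A : Set (ℝ × ℝ), ∫⁻ z in A, f z ≤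
      (∫⁻ z in A, ENNReal.ofReal (g z)) + ENNReal.ofReal δ := fun A => by
    calc ∫⁻ z in A, f z
        ≤ ∫⁻ z in A, (ENNReal.ofReal (g z) + ‖(f z).toReal - g z‖ₑ) :=
          lintegral_mono_ae <| (ae_restrict_of_ae hfr).mono fun z hz => by
            rw [hz]
            convert hsub_le (f z).toReal (g z) using 3
            rw [← hz]
      _ = (∫⁻ z in A, ENNReal.ofReal (g z)) + ∫⁻ z in A, ‖(f z).toReal - g z‖ₑ :=
          lintegral_add_left hgc.measurable.ennreal_ofReal _
      _ ≤ _ := by gcongr; exact (setLIntegral_le_lintegral _ _).trans hgf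
  have hgD : ∫⁻ z in D, ENNReal.ofReal (g z) ≤ ENNReal.ofReal (1 + δ) := by
    calc ∫⁻ z in D, ENNReal.ofReal (g z)
        ≤ ∫⁻ z, ENNReal.ofReal (g z) := setLIntegral_le_lintegral _ _
      _ ≤ ∫⁻ z, (f z + ‖(f z).toReal - g z‖ₑ) :=
          lintegral_mono_ae <| hfr.mono fun z hz => by
            have := hsub_le (g z) (f z).toReal
            rwa [← hz, enorm_sub_rev] at this
      _ = 1 + ∫⁻ z, ‖(f z).toReal - g z‖ₑ := by rw [lintegral_add_left hfm, hf1]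
      _ ≤ 1 + ENNReal.ofReal δ := by gcongr
      _ = _ := by rw [ENNReal.ofReal_add zero_le_one hδ.le, ENNReal.ofReal_one]
  obtain ⟨r, hr, hgr⟩ := Metric.uniformContinuous_iff.1
    (hgs.uniformContinuous_of_continuous hgc) δ hδ
  obtain ⟨M, hM⟩ := exists_nat_one_div_lt hr
  set ρ : ℝ := 1 / ((M : ℝ) + 1) with hρ
  have hρ0 : 0 < ρ := by positivity
  have hMρ : ((M : ℝ) + 1) * ρ = 1 := by rw [hρ]; field_simp
  set cell : ℕ × ℕ → Set (ℝ × ℝ) := fun v =>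
    Set.Ico (v.1 * ρ) (v.1 * ρ + ρ) ×ˢ Set.Ico (v.2 * ρ) (v.2 * ρ + ρ) with hcell
  set V := Finset.range (M + 1) ×ˢ Finset.range (M + 1) with hV
  have hcellm : ∀ v, MeasurableSet (cell v) := fun v => measurableSet_Ico.prod measurableSet_Ico
  have hfloor : ∀ (k : ℕ) (x : ℝ), x ∈ Set.Ico (k * ρ) (k * ρ + ρ) → ⌊x / ρ⌋₊ = k := by
    rintro k x ⟨h1, h2⟩
    have hx : 0 ≤ x := le_trans (by positivity) h1
    rw [Nat.floor_eq_iff (by positivity), le_div_iff₀ hρ0, div_lt_iff₀ hρ0]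
    exact ⟨h1, by linarith⟩
  have hdisj : (V : Set (ℕ × ℕ)).PairwiseDisjoint cell := by
    intro v _ w _ hvw
    rw [Function.onFun, Set.disjoint_left]
    rintro z ⟨h1, h2⟩ ⟨h3, h4⟩
    exact hvw (Prod.ext ((hfloor _ _ h1).symm.trans (hfloor _ _ h3))
      ((hfloor _ _ h2).symm.trans (hfloor _ _ h4)))
  have hmem : ∀ x ∈ Set.Ico (0 : ℝ) 1, ∃ k ∈ Finset.range (M + 1),
      x ∈ Set.Ico (k * ρ) (k * ρ + ρ) := by
    rintro x ⟨h1, h2⟩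
    have h3 := Nat.floor_le (div_nonneg h1 hρ0.le)
    have h4 := Nat.lt_floor_add_one (x / ρ)
    rw [le_div_iff₀ hρ0] at h3
    rw [div_lt_iff₀ hρ0] at h4
    refine ⟨⌊x / ρ⌋₊, ?_, h3, by linarith⟩
    rw [Finset.mem_range, Nat.floor_lt (div_nonneg h1 hρ0.le), div_lt_iff₀ hρ0]
    push_cast
    linarith
  have hsubIco : ∀ k ∈ Finset.range (M + 1),
      Set.Ico (k * ρ) (k * ρ + ρ) ⊆ Set.Ico (0 : ℝ) 1 := by
    intro k hk
    refine Set.Ico_subset_Ico (by positivity) ?_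
    have : (k : ℝ) + 1 ≤ M + 1 := by exact_mod_cast Finset.mem_range.1 hk
    nlinarith
  have hunion : ⋃ v ∈ V, cell v = D := by
    ext ⟨x, y⟩
    simp only [Set.mem_iUnion]
    constructor
    · rintro ⟨v, hv, hx, hy⟩
      rw [hV, Finset.mem_product] at hv
      exact ⟨hsubIco _ hv.1 hx, hsubIco _ hv.2 hy⟩
    · rintro ⟨hx, hy⟩
      obtain ⟨i, hi, hix⟩ := hmem x hx
      obtain ⟨j, hj, hjy⟩ := hmem y hy
      exact ⟨(i, j), Finset.mem_product.2 ⟨hi, hj⟩, hix, hjy⟩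
  have hcellvol : ∀ v, volume (cell v) = ENNReal.ofReal (ρ ^ 2) := fun v => by
    simp only [hcell]
    rw [Measure.volume_eq_prod, Measure.prod_prod, Real.volume_Ico, Real.volume_Ico,
      ← ENNReal.ofReal_mul (by linarith)]
    congr 1; ring
  set w : ℕ × ℕ → ℝ := fun v => g (v.1 * ρ, v.2 * ρ) with hw
  have hdist : ∀ v, ∀ z ∈ cell v, |g z - w v| ≤ δ := by
    rintro v ⟨x, y⟩ ⟨⟨h1, h2⟩, h3, h4⟩
    simp only at h1 h2 h3 h4
    refine (hgr ?_).le
    rw [Prod.dist_eq, max_lt_iff, Real.dist_eq, Real.dist_eq, abs_lt, abs_lt]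
    refine ⟨⟨?_, ?_⟩, ?_, ?_⟩ <;> simp only <;> linarith
  have hcellsum : ∑ v ∈ V, ENNReal.ofReal (w v + δ) * ENNReal.ofReal (ρ ^ 2) ≤
      ENNReal.ofReal (1 + 3 * δ) := by
    calc ∑ v ∈ V, ENNReal.ofReal (w v + δ) * ENNReal.ofReal (ρ ^ 2)
        = ∑ v ∈ V, ∫⁻ _ in cell v, ENNReal.ofReal (w v + δ) :=
          Finset.sum_congr rfl fun v _ => by rw [setLIntegral_const, hcellvol]
      _ ≤ ∑ v ∈ V, ∫⁻ z in cell v, (ENNReal.ofReal (g z) + ENNReal.ofReal (2 * δ)) := by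
          refine Finset.sum_le_sum fun v _ => setLIntegral_mono' (hcellm v) fun z hz => ?_
          refine (ENNReal.ofReal_le_ofReal ?_).trans ENNReal.ofReal_add_le
          linarith [(abs_le.1 (hdist v z hz)).1]
      _ = (∫⁻ z in D, ENNReal.ofReal (g z)) + ENNReal.ofReal (2 * δ) := by
          rw [← lintegral_biUnion_finset hdisj fun v _ => hcellm v, hunion,
            lintegral_add_right _ measurable_const, setLIntegral_const, hDvol, mul_one]
      _ ≤ ENNReal.ofReal (1 + δ) + ENNReal.ofReal (2 * δ) := by gcongr
      _ = _ := by rw [← ENNReal.ofReal_add (by positivity) (by positivity)]; congr 1; ring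
  have hall : ∀ᶠ i in l, ∀ v ∈ V, volume (U i ∩ cell v) ≤ ENNReal.ofReal (c * ρ ^ 2) :=
    (Finset.eventually_all V).2 fun v _ => hbox ρ hρ0 _ _
  filter_upwards [hall] with i hi
  have hUD : U i ∩ D = ⋃ v ∈ V, U i ∩ cell v := by rw [← hunion, Set.inter_iUnion₂]
  have hDc : P Dᶜ = 0 := (prob_compl_eq_zero_iff hDm).2 hsupp
  calc P (U i) = P (U i ∩ D) := (measure_inter_conull hDc).symm
    _ = ∫⁻ z in U i ∩ D, f z := by rw [← withDensity_apply _ ((hU i).inter hDm), hPf]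
    _ ≤ (∫⁻ z in U i ∩ D, ENNReal.ofReal (g z)) + ENNReal.ofReal δ := hfg _
    _ = (∑ v ∈ V, ∫⁻ z in U i ∩ cell v, ENNReal.ofReal (g z)) + ENNReal.ofReal δ := by
        rw [hUD, lintegral_biUnion_finset
          (hdisj.mono fun v => Set.inter_subset_right) fun v _ => (hU i).inter (hcellm v)]
    _ ≤ (∑ v ∈ V, ∫⁻ _ in U i ∩ cell v, ENNReal.ofReal (w v + δ)) + ENNReal.ofReal δ := by
        refine add_le_add_left (Finset.sum_le_sum fun v _ => ?_) _
        refine setLIntegral_mono' ((hU i).inter (hcellm v)) fun z hz => ?_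
        exact ENNReal.ofReal_le_ofReal (by linarith [(abs_le.1 (hdist v z hz.2)).2])
    _ ≤ (∑ v ∈ V, ENNReal.ofReal c * (ENNReal.ofReal (w v + δ) * ENNReal.ofReal (ρ ^ 2))) +
          ENNReal.ofReal δ := by
        gcongr with v hv
        rw [setLIntegral_const, mul_left_comm, ← ENNReal.ofReal_mul hc]
        gcongr
        exact hi v hv
    _ ≤ ENNReal.ofReal c * ENNReal.ofReal (1 + 3 * δ) + ENNReal.ofReal δ := by
        rw [← Finset.mul_sum]; gcongr
    _ = _ := by
        rw [← ENNReal.ofReal_mul hc, ← ENNReal.ofReal_add (by positivity) hδ.le]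

theorem stmt_15 (s : ℝ) (hs : 0 < s)
    (P : Measure (ℝ × ℝ)) [IsProbabilityMeasure P]
    (hsupp : P (Set.Ico (0:ℝ) 1 ×ˢ Set.Ico (0:ℝ) 1) = 1)
    (habs : P ≪ (volume : Measure (ℝ × ℝ))) :
    ∃ C : ℝ, ∀ k : ℕ, 1 ≤ k → ∀ L : ℝ,
      Filter.Tendsto (fun ε : ℝ => (P {p | k ≤ visits p.1 p.2 ε s}).toReal)
        (nhdsWithin 0 (Set.Ioi 0)) (nhds L) →
      L ≤ C / (k : ℝ)^3 := by
  set m := 2 * ⌊2 * s⌋₊ + 1 with hm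
  refine ⟨8 * m ^ 3 * (1 + 12 * s ^ 2), fun k hk L hL => ?_⟩
  have hk0 : (0 : ℝ) < k := by exact_mod_cast hk
  have hm0 : 0 < m := by omega
  have hm0r : (0 : ℝ) < m := by exact_mod_cast hm0
  rcases lt_or_ge k (2 * m) with hkm | hkm
  · have hL1 : L ≤ 1 := le_of_tendsto' hL fun ε => measureReal_le_one
    refine hL1.trans ?_
    have hkr : (k : ℝ) ≤ 2 * m := by exact_mod_cast hkm.le
    rw [le_div_iff₀ (by positivity), one_mul]
    calc (k : ℝ) ^ 3 ≤ (2 * (m : ℝ)) ^ 3 := by gcongr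
      _ = 8 * (m : ℝ) ^ 3 * 1 := by ring
      _ ≤ _ := by gcongr; nlinarith
  · obtain ⟨n, hmn, hkn⟩ : ∃ n, m * n < k ∧ k ≤ m * n + m := by
      have h1 := Nat.mul_div_le (k - 1) m
      have h2 := Nat.lt_mul_div_succ (k - 1) hm0
      rw [mul_add, mul_one] at h2
      exact ⟨(k - 1) / m, by omega, by omega⟩
    have hn1 : 1 ≤ n := by
      rw [Nat.one_le_iff_ne_zero]
      rintro rfl
      omega
    have hk2 : (k : ℝ) ≤ 2 * m * n := by
      have : k ≤ 2 * m * n := by nlinarith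
      exact_mod_cast this
    have hn0 : (0 : ℝ) < n := by exact_mod_cast hn1
    set c := 12 * s ^ 2 / (n : ℝ) ^ 3 with hc
    have hc0 : 0 ≤ c := by positivity
    have hpos : ∀ᶠ ε : ℝ in nhdsWithin 0 (Set.Ioi 0), 0 < ε := self_mem_nhdsWithin
    have hsmall : ∀ b : ℝ, 0 < b → ∀ᶠ ε : ℝ in nhdsWithin 0 (Set.Ioi 0), ε < b := fun b hb =>
      Filter.mem_of_superset (Ioo_mem_nhdsGT hb) fun _ h => h.2
    have hbound : ∀ δ : ℝ, 0 < δ → L ≤ (c + δ) * (1 + 3 * δ) + δ := by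
      intro δ hδ
      have hbox : ∀ ρ : ℝ, 0 < ρ → ∀ a b : ℝ, ∀ᶠ ε in nhdsWithin (0 : ℝ) (Set.Ioi 0),
          volume (visitsCover s n ε ∩ Set.Ico a (a + ρ) ×ˢ Set.Ico b (b + ρ)) ≤
            ENNReal.ofReal ((c + δ) * ρ ^ 2) := by
        intro ρ hρ a b
        filter_upwards [hpos, hsmall 1 one_pos,
          hsmall (δ * ρ ^ 2 / (24 * s * (3 * s + 3) ^ 2)) (by positivity)] with ε h0 h1 h2
        refine (volume_visitsCover_inter_box_le hs hn1 hρ.le h0 h1.le a b).trans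
          (ENNReal.ofReal_le_ofReal ?_)
        rw [lt_div_iff₀ (by positivity)] at h2
        linarith
      refine le_of_tendsto hL ?_
      filter_upwards [hpos, eventually_measure_le_of_box_density hsupp habs
        (measurableSet_visitsCover s n) (by positivity) hbox hδ] with ε h0 hε
      refine ENNReal.toReal_le_of_le_ofReal (by positivity) (le_trans (measure_mono ?_) hε)
      rintro ⟨x, α⟩ hx
      exact mem_visitsCover_of_lt_visits h0 hn1 (lt_of_lt_of_le hmn hx)
    have hLc : L ≤ c := by
      have hcont : Continuous fun δ : ℝ => (c + δ) * (1 + 3 * δ) + δ := by fun_prop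
      have hlim : Filter.Tendsto (fun δ : ℝ => (c + δ) * (1 + 3 * δ) + δ)
          (nhdsWithin 0 (Set.Ioi 0)) (nhds c) := by
        have := (hcont.tendsto 0).mono_left (nhdsWithin_le_nhds (s := Set.Ioi 0))
        simpa using this
      exact ge_of_tendsto hlim (hpos.mono hbound)
    refine hLc.trans ?_
    rw [hc, div_le_div_iff₀ (by positivity) (by positivity)]
    calc 12 * s ^ 2 * (k : ℝ) ^ 3 ≤ 12 * s ^ 2 * (2 * m * n) ^ 3 := by gcongr
      _ = 8 * m ^ 3 * (12 * s ^ 2) * n ^ 3 := by ring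
      _ ≤ _ := by gcongr; linarith
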